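/- Let e = R_{e₁,e₋₂} + R_{e₂,e₋₃} + R_{e₃,e₀} and h = 6·R_{e₁,e₋₁} + 4·R_{e₂,e₋₂} + 2·R_{e₃,e₋₃}, both elements of so(V, β). Then there exists f ∈ so(V, β) such that ⁅h, e⁆ = 2·e, ⁅h, f⁆ = −2·f, and ⁅e, f⁆ = h (so {e, h, f} is an sl(2)-triple in so(V, β)). -/

import Mathlib

noncomputable section

/-- `V = ℂ⁷` with ordered basis `(e₁, e₂, e₃, e₀, e₋₃, e₋₂, e₋₁)`. -/
abbrev V7 : Type := Fin 7 → ℂ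

/-- The Gram matrix of the symmetric bilinear form `β` in the ordered basis
`(e₁, e₂, e₃, e₀, e₋₃, e₋₂, e₋₁)`:  `β(eᵢ, e₋ᵢ) = β(e₋ᵢ, eᵢ) = 1`, `β(e₀,e₀) = 2`,
all other pairs `0`. -/
def Bmat : Matrix (Fin 7) (Fin 7) ℂ :=
  Matrix.of fun i j =>
    if (i : ℕ) + (j : ℕ) = 6 then (if (i : ℕ) = 3 then 2 else 1) else 0

/-- The symmetric bilinear form `β` on `V`. -/
def beta : V7 →ₗ[ℂ] V7 →ₗ[ℂ] ℂ := Matrix.toBilin' Bmat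

/-- `so(V, β) = {x ∈ End(V) : β(xu, w) + β(u, xw) = 0 for all u, w}`. -/
def so7 : Set (Module.End ℂ V7) :=
  {x | ∀ u w : V7, beta (x u) w + beta u (x w) = 0}

/-- `R_{u,w}(v) = β(w,v) • u − β(u,v) • w`. -/
def Rm (u w : V7) : Module.End ℂ V7 :=
  (beta w).smulRight u - (beta u).smulRight w

def e1 : V7 := Pi.single 0 1
def e2 : V7 := Pi.single 1 1
def e3 : V7 := Pi.single 2 1
def e0 : V7 := Pi.single 3 1
def em3 : V7 := Pi.single 4 1
def em2 : V7 := Pi.single 5 1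
def em1 : V7 := Pi.single 6 1

/-- The nilpotent element. -/
def eNil : Module.End ℂ V7 := Rm e1 em2 + Rm e2 em3 + Rm e3 e0

/-- The semisimple element. -/
def hSem : Module.End ℂ V7 := (6:ℂ) • Rm e1 em1 + (4:ℂ) • Rm e2 em2 + (2:ℂ) • Rm e3 em3

/-- The form `β` in coordinates. -/
theorem beta_apply (u v : V7) :
    beta u v = u 0 * v 6 + u 1 * v 5 + u 2 * v 4 + 2 * (u 3 * v 3) + u 4 * v 2 + u 5 * v 1 +
      u 6 * v 0 := by
  simp [beta, Bmat, Matrix.toBilin'_apply, Fin.sum_univ_succ, Fin.succ]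
  ring

theorem beta_comm (u v : V7) : beta u v = beta v u := by
  simp only [beta_apply]
  ring

theorem Rm_apply (u w v : V7) : Rm u w v = beta w v • u - beta u v • w := rfl

theorem Rm_mem_so7 (u w : V7) : Rm u w ∈ so7 := by
  intro x y
  simp only [Rm_apply, map_sub, map_smul, LinearMap.sub_apply, LinearMap.smul_apply, smul_eq_mul,
    beta_comm x]
  ring

theorem add_mem_so7 {x y : Module.End ℂ V7} (hx : x ∈ so7) (hy : y ∈ so7) : x + y ∈ so7 := by
  intro u w
  simp only [LinearMap.add_apply, map_add]
  linear_combination hx u w + hy u w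

theorem smul_mem_so7 (c : ℂ) {x : Module.End ℂ V7} (hx : x ∈ so7) : c • x ∈ so7 := by
  intro u w
  simp only [LinearMap.smul_apply, map_smul, smul_eq_mul]
  linear_combination c * hx u w

/-- The nilpotent element opposite to `eNil`. -/
def fNil : Module.End ℂ V7 := (6 : ℂ) • Rm e2 em1 + (10 : ℂ) • Rm e3 em2 + (6 : ℂ) • Rm e0 em3

theorem fNil_mem_so7 : fNil ∈ so7 :=
  add_mem_so7 (add_mem_so7 (smul_mem_so7 _ (Rm_mem_so7 _ _)) (smul_mem_so7 _ (Rm_mem_so7 _ _)))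
    (smul_mem_so7 _ (Rm_mem_so7 _ _))

theorem eNil_apply (v : V7) :
    eNil v = ![v 1, v 2, 2 * v 3, -v 4, -v 5, -v 6, 0] := by
  ext i
  fin_cases i <;>
    simp [eNil, Rm_apply, beta_apply, e1, e2, e3, e0, em3, em2]

theorem hSem_apply (v : V7) :
    hSem v = ![6 * v 0, 4 * v 1, 2 * v 2, 0, -2 * v 4, -4 * v 5, -6 * v 6] := by
  ext i
  fin_cases i <;>
    simp [hSem, Rm_apply, beta_apply, e1, e2, e3, em3, em2, em1]

theorem fNil_apply (v : V7) :
    fNil v = ![0, 6 * v 0, 10 * v 1, 6 * v 2, -12 * v 3, -10 * v 4, -6 * v 5] := by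
  ext i
  fin_cases i <;>
    simp [fNil, Rm_apply, beta_apply, e2, e3, e0, em3, em2, em1]
  ring

theorem lie_hSem_eNil : ⁅hSem, eNil⁆ = (2 : ℂ) • eNil := by
  refine LinearMap.ext fun v => funext fun i => ?_
  fin_cases i <;> simp [Ring.lie_def, hSem_apply, eNil_apply] <;> ring

theorem lie_hSem_fNil : ⁅hSem, fNil⁆ = (-2 : ℂ) • fNil := by
  refine LinearMap.ext fun v => funext fun i => ?_
  fin_cases i <;> simp [Ring.lie_def, hSem_apply, fNil_apply] <;> ring

theorem lie_eNil_fNil : ⁅eNil, fNil⁆ = hSem := by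
  refine LinearMap.ext fun v => funext fun i => ?_
  fin_cases i <;> simp [Ring.lie_def, hSem_apply, eNil_apply, fNil_apply] <;> ring

theorem statement7 :
    ∃ f ∈ so7, ⁅hSem, eNil⁆ = (2 : ℂ) • eNil ∧ ⁅hSem, f⁆ = (-2 : ℂ) • f ∧ ⁅eNil, f⁆ = hSem := by
  exact ⟨fNil, fNil_mem_so7, lie_hSem_eNil, lie_hSem_fNil, lie_eNil_fNil⟩
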